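/- arXiv:1701.08321 — 2 statements merged into one kernel-verified Lean document; each statement's English description precedes it below -/
import Mathlib

section
/- Let A be a (possibly infinite) geometrically fast set of positive bump functions in Homeo₊(I), equipped with a marking witnessing fastness. If s ∈ I has finite history, u is a word locally reduced at s, and w is a word with |w| < |u|, then the concatenation uw has no return prefix for s; that is, no nonempty prefix v of uw satisfies sv = s. -/
open Set

/-- The unit interval `[0,1]` as a type. -/
abbrev UI : Type := ↥unitInterval

/-- Bijections of the unit interval; orientation-preserving homeomorphisms are
exactly the monotone ones among these. -/
abbrev Homeo01 : Type := Equiv.Perm UI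

namespace PingPong

/-- The support of `f`. -/
def supt (f : Homeo01) : Set UI := {t | f t ≠ t}

/-- `f` is an orientation-preserving homeomorphism of `[0,1]`:
a monotone bijection of `[0,1]` (automatically a homeomorphism). -/
def IsOPH (f : Homeo01) : Prop := Monotone ⇑f

/-- A bump function: an orientation preserving homeomorphism with exactly one
orbital, i.e. whose support is nonempty and connected. -/
def IsBump (f : Homeo01) : Prop := IsOPH f ∧ IsConnected (supt f)

/-- A positive bump function. -/
def IsPosBump (f : Homeo01) : Prop := IsBump f ∧ ∀ t ∈ supt f, t < f t

/-- The source of a positive bump `a` with marker `t`. -/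
def src (a : Homeo01) (t : UI) : Set UI := {s ∈ supt a | s < t}

/-- The destination of a positive bump `a` with marker `t`. -/
def dest (a : Homeo01) (t : UI) : Set UI := {s ∈ supt a | a t ≤ s}

/-- `m` is a marking of the collection `A` of bumps. -/
def IsMarking (A : Set Homeo01) (m : Homeo01 → UI) : Prop := ∀ a ∈ A, m a ∈ supt a

/-- The feet of a marked bump: `false` gives the source, `true` the destination. -/
def foot (a : Homeo01) (t : UI) : Bool → Set UI
  | false => src a t
  | true => dest a t

/-- The feet of the marked family `(A, m)` are pairwise disjoint. -/
def FeetDisjoint (A : Set Homeo01) (m : Homeo01 → UI) : Prop :=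
  ∀ a ∈ A, ∀ b ∈ A, ∀ i j : Bool, (a, i) ≠ (b, j) →
    Disjoint (foot a (m a) i) (foot b (m b) j)

/-- A geometrically fast collection of (positive) bumps. -/
def FastBumps (A : Set Homeo01) : Prop :=
  (∀ a ∈ A, IsPosBump a) ∧ ∃ m : Homeo01 → UI, IsMarking A m ∧ FeetDisjoint A m

/-- `t` is a left transition point of `f`. -/
def IsLeftTransition (f : Homeo01) (t : UI) : Prop :=
  t ∉ supt f ∧ ∀ ε : ℝ, 0 < ε → ∃ s ∈ supt f, t < s ∧ (s : ℝ) < (t : ℝ) + ε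

/-- `t` is a right transition point of `f`. -/
def IsRightTransition (f : Homeo01) (t : UI) : Prop :=
  t ∉ supt f ∧ ∀ ε : ℝ, 0 < ε → ∃ s ∈ supt f, s < t ∧ (t : ℝ) - ε < (s : ℝ)

/-- `t` is a transition point of `f`. -/
def IsTransition (f : Homeo01) (t : UI) : Prop :=
  IsLeftTransition f t ∨ IsRightTransition f t

/-- A geometrically proper set of homeomorphisms. -/
def GeomProper (X : Set Homeo01) : Prop :=
  (∀ f ∈ X, ∀ g ∈ X, f ≠ g → ∀ t : UI, ¬(IsLeftTransition f t ∧ IsLeftTransition g t)) ∧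
  (∀ f ∈ X, ∀ g ∈ X, f ≠ g → ∀ t : UI, ¬(IsRightTransition f t ∧ IsRightTransition g t))

/-- The positive bump `a` is used in `f`. -/
def UsedIn (f a : Homeo01) : Prop :=
  IsPosBump a ∧ (Set.EqOn ⇑f ⇑a (supt a) ∨ Set.EqOn ⇑f ⇑a⁻¹ (supt a))

/-- The set of (positive) bumps used in `X`. -/
def usedBumps (X : Set Homeo01) : Set Homeo01 := {a | ∃ f ∈ X, UsedIn f a}

/-- A geometrically fast set of homeomorphisms. -/
def GeomFast (X : Set Homeo01) : Prop := GeomProper X ∧ FastBumps (usedBumps X)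

/-- The set of transition points of elements of `X`. -/
def transitionPoints (X : Set Homeo01) : Set UI := {t | ∃ f ∈ X, IsTransition f t}

/-! ### Words -/

/-- A word in the alphabet `A^± = A ∪ A⁻¹`, recorded as a list of the permutations
represented by its symbols (for a set `A` of positive bumps this is faithful,
since `A ∩ A⁻¹ = ∅`). -/
def WordOn (A : Set Homeo01) (w : List Homeo01) : Prop := ∀ x ∈ w, x ∈ A ∨ x⁻¹ ∈ A

/-- A freely reduced word: no symbol is immediately followed by its inverse. -/
def FreelyReduced (w : List Homeo01) : Prop := List.Chain' (fun a b => b ≠ a⁻¹) w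

/-- The right action of a word on a point: apply the symbols from left to right. -/
def act (t : UI) (w : List Homeo01) : UI := w.foldl (fun s a => a s) t

/-- `w` is locally reduced at `t`. -/
def LocallyReducedAt (w : List Homeo01) (t : UI) : Prop :=
  FreelyReduced w ∧ ∀ (u : List Homeo01) (a : Homeo01), u ++ [a] <+: w → a (act t u) ≠ act t u

open Classical in
/-- The source of a symbol of `A^±`: for `a ∈ A` it is `src a`, and for the
formal inverse of an element of `A` it is the destination of that element. -/
noncomputable def symSrc (A : Set Homeo01) (m : Homeo01 → UI) (b : Homeo01) : Set UI :=
  if b ∈ A then src b (m b) else dest b⁻¹ (m b⁻¹)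

open Classical in
/-- The destination of a symbol of `A^±`. -/
noncomputable def symDest (A : Set Homeo01) (m : Homeo01 → UI) (b : Homeo01) : Set UI :=
  if b ∈ A then dest b (m b) else src b⁻¹ (m b⁻¹)

/-- The source of a word: the source of its first symbol (empty for the empty word). -/
noncomputable def wordSrc (A : Set Homeo01) (m : Homeo01 → UI) : List Homeo01 → Set UI
  | [] => ∅
  | a :: _ => symSrc A m a

/-- The destination of a word: the destination of its last symbol. -/
noncomputable def wordDest (A : Set Homeo01) (m : Homeo01 → UI) (w : List Homeo01) : Set UI :=
  match w.getLast? with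
  | none => ∅
  | some a => symDest A m a

/-- `J(w) = supt(a) \ src(a)` where `a` is the first symbol of `w`. -/
noncomputable def Jset (A : Set Homeo01) (m : Homeo01 → UI) : List Homeo01 → Set UI
  | [] => ∅
  | a :: _ => supt a \ symSrc A m a

/-- `t` has trivial history: it lies in no foot of any element of `A`. -/
def TrivialHistory (A : Set Homeo01) (m : Homeo01 → UI) (t : UI) : Prop :=
  ∀ a ∈ A, t ∉ src a (m a) ∧ t ∉ dest a (m a)

/-- `x` has finite history: there is a finite bound on the lengths of `A`-words
locally reduced at `x` whose evaluation at `x` is outside their destination. -/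
def FiniteHistory (A : Set Homeo01) (m : Homeo01 → UI) (x : UI) : Prop :=
  ∃ n : ℕ, ∀ w : List Homeo01, WordOn A w → LocallyReducedAt w x →
    act x w ∉ wordDest A m w → w.length ≤ n

/-- A return word for `x`. -/
def IsReturnWord (x : UI) (w : List Homeo01) : Prop := w ≠ [] ∧ act x w = x

/-- `w` has a return prefix for `x`. -/
def HasReturnPrefix (x : UI) (w : List Homeo01) : Prop :=
  ∃ v : List Homeo01, v <+: w ∧ IsReturnWord x v

/-- The set of initial markers of the marked family `(A, m)`. -/
def initialMarkers (A : Set Homeo01) (m : Homeo01 → UI) : Set UI :=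
  {t | (∃ a ∈ A, m a = t) ∧ ∀ b ∈ A, m b < t → b (m b) ≠ t}

/-- `M⟨X⟩`: the orbit of the set of initial markers of `(A, m)` under the group
generated by `X`. -/
def MOrbit (A : Set Homeo01) (m : Homeo01 → UI) (X : Set Homeo01) : Set UI :=
  {u | ∃ t ∈ initialMarkers A m, ∃ g ∈ Subgroup.closure X, g t = u}

end PingPong
namespace PingPong

/-! ### Piecewise linear maps and Thompson's group F -/

/-- `f` is piecewise linear (finitely many affine pieces). -/
def IsPL (f : Homeo01) : Prop :=
  ∃ (n : ℕ) (t : Fin (n + 1) → ℝ), StrictMono t ∧ t 0 = 0 ∧ t (Fin.last n) = 1 ∧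
    ∀ i : Fin n, ∃ c d : ℝ, ∀ s : UI,
      t i.castSucc ≤ (s : ℝ) → (s : ℝ) ≤ t i.succ → ((f s : ℝ)) = c * (s : ℝ) + d

/-- `x` is a dyadic rational. -/
def IsDyadic (x : ℝ) : Prop := ∃ (a : ℤ) (k : ℕ), x = (a : ℝ) / 2 ^ k

/-- `f` belongs to Thompson's group `F`: an orientation-preserving piecewise linear
homeomorphism of `[0,1]` with dyadic breakpoints and slopes integer powers of `2`. -/
def InThompsonF (f : Homeo01) : Prop :=
  IsOPH f ∧
  ∃ (n : ℕ) (t : Fin (n + 1) → ℝ), StrictMono t ∧ t 0 = 0 ∧ t (Fin.last n) = 1 ∧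
    (∀ i, IsDyadic (t i)) ∧
    ∀ i : Fin n, ∃ (k : ℤ) (d : ℝ), ∀ s : UI,
      t i.castSucc ≤ (s : ℝ) → (s : ℝ) ≤ t i.succ → ((f s : ℝ)) = (2 : ℝ) ^ k * (s : ℝ) + d

/-! ### Stretched transition chains -/

/-- `a` is isolated in `A`: its support contains no transition point of an element of `A`. -/
def IsolatedIn (A : Set Homeo01) (a : Homeo01) : Prop :=
  ∀ t ∈ supt a, ∀ b ∈ A, ¬ IsTransition b t

/-- `c` (with supports `(x i, y i)`) is a stretched transition chain of `A`. -/
def IsSTC (A : Set Homeo01) (k : ℕ) (c : Fin (k + 1) → Homeo01)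
    (x y : Fin (k + 1) → ℝ) : Prop :=
  (∀ i, c i ∈ A ∧ ¬ IsolatedIn A (c i)) ∧
  (∀ i, supt (c i) = {t : UI | x i < (t : ℝ) ∧ (t : ℝ) < y i}) ∧
  (∀ i : Fin k, x i.castSucc < x i.succ ∧ x i.succ < y i.castSucc ∧ y i.castSucc < y i.succ) ∧
  (∀ i : Fin k, ∀ t : UI, x i.succ < (t : ℝ) → (t : ℝ) < y i.castSucc →
    ∀ b ∈ A, ¬ IsTransition b t)

/-- `S` is the underlying set of some stretched transition chain of `A`. -/
def ChainSet (A : Set Homeo01) (S : Set Homeo01) : Prop :=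
  ∃ (k : ℕ) (c : Fin (k + 1) → Homeo01) (x y : Fin (k + 1) → ℝ),
    IsSTC A k c x y ∧ S = Set.range c

/-- `S` is the underlying set of a maximal stretched transition chain of `A`. -/
def MaxChainSet (A : Set Homeo01) (S : Set Homeo01) : Prop :=
  ChainSet A S ∧ ∀ S' : Set Homeo01, ChainSet A S' → S ⊆ S' → S = S'

/-- The transition points of `A` lying in the support of the chain `c`. -/
def chainTrans (A : Set Homeo01) (k : ℕ) (c : Fin (k + 1) → Homeo01) : Set UI :=
  {t | (∃ i, t ∈ supt (c i)) ∧ ∃ b ∈ A, IsTransition b t}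

/-- The image of `t` under the composition `∏ C = c 0 ⋯ c k`. -/
def chainApply (k : ℕ) (c : Fin (k + 1) → Homeo01) (t : UI) : UI :=
  (List.ofFn c).foldl (fun s a => a s) t

/-! ### Dynamical diagrams -/

/-- The collection of feet of the bumps used in `X`, with marking `m`. -/
def Feet (X : Set Homeo01) (m : Homeo01 → UI) : Set (Set UI) :=
  {S | ∃ a ∈ usedBumps X, S = src a (m a) ∨ S = dest a (m a)}

/-- The signed bumps of `f`: bumps agreeing with `f` on their support. -/
def signedBumps (f : Homeo01) : Set Homeo01 :=
  {b | IsBump b ∧ Set.EqOn ⇑b ⇑f (supt b)}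

open Classical in
/-- The source of a signed bump, with respect to the marking `m` of the positive bumps. -/
noncomputable def sSrc (m : Homeo01 → UI) (b : Homeo01) : Set UI :=
  if IsPosBump b then src b (m b) else dest b⁻¹ (m b⁻¹)

open Classical in
/-- The destination of a signed bump, with respect to the marking `m` of the positive bumps. -/
noncomputable def sDest (m : Homeo01 → UI) (b : Homeo01) : Set UI :=
  if IsPosBump b then dest b (m b) else src b⁻¹ (m b⁻¹)

/-- An isomorphism of the dynamical diagrams of the marked families `(X, mX)` and
`(Y, mY)`, inducing the bijection `τ : X → Y`: an order-preserving bijection `Φ`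
between the collections of feet, together with, for each `f ∈ X`, a bijection of the
signed bumps of `f` with those of `τ f` under which `Φ` matches sources with sources
and destinations with destinations. -/
def DiagIso (X : Set Homeo01) (mX : Homeo01 → UI) (Y : Set Homeo01) (mY : Homeo01 → UI)
    (τ : Homeo01 → Homeo01) : Prop :=
  Set.BijOn τ X Y ∧
  ∃ Φ : Set UI → Set UI,
    Set.BijOn Φ (Feet X mX) (Feet Y mY) ∧
    (∀ S ∈ Feet X mX, ∀ T ∈ Feet X mX,
      (∀ s ∈ S, ∀ t ∈ T, s < t) → ∀ s ∈ Φ S, ∀ t ∈ Φ T, s < t) ∧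
    ∀ f ∈ X, ∃ β : Homeo01 → Homeo01,
      Set.BijOn β (signedBumps f) (signedBumps (τ f)) ∧
      ∀ b ∈ signedBumps f, Φ (sSrc mX b) = sSrc mY (β b) ∧ Φ (sDest mX b) = sDest mY (β b)

/-! ### Excision -/

/-- The union of the supports of the bumps of `E` used in `f`. -/
def quotSupp (f : Homeo01) (E : Set Homeo01) : Set UI :=
  {t | ∃ a ∈ E, UsedIn f a ∧ t ∈ supt a}

/-- `g = f/E`: `g` is the identity on the supports of the bumps of `E` used in `f`,
and agrees with `f` elsewhere. -/
def IsQuot (f : Homeo01) (E : Set Homeo01) (g : Homeo01) : Prop :=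
  (∀ t ∈ quotSupp f E, g t = t) ∧ ∀ t ∉ quotSupp f E, g t = f t

/-- `E` is extraneous in `X` (with respect to the marking `m`), witnessed by an
interval `J`. -/
def Extraneous (X : Set Homeo01) (m : Homeo01 → UI) (E : Set Homeo01) : Prop :=
  ∃ J : Set UI, J.OrdConnected ∧ ∃ f ∈ X,
    (∀ e ∈ E, UsedIn f e ∧ IsolatedIn (usedBumps X) e ∧ supt e ⊆ J) ∧
    (∃ a : Homeo01, UsedIn f a ∧ a ∉ E ∧ (src a (m a) ⊆ J ∨ dest a (m a) ⊆ J)) ∧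
    ∀ g ∈ X, g ≠ f → ∀ b : Homeo01, UsedIn g b →
      Disjoint (src b (m b)) J ∧ Disjoint (dest b (m b)) J

end PingPong
namespace PingPong

/-- A set `S` of symbols, closed under inverses, in which every `b ∈ S` has a source `F b`
and destination `F b⁻¹` satisfying the ping-pong conditions. -/
structure IsPingPong (S : Set Homeo01) (F : Homeo01 → Set UI) : Prop where
  inv_mem : ∀ b ∈ S, b⁻¹ ∈ S
  apply_mem : ∀ b ∈ S, ∀ x, b x ≠ x → x ∉ F b → b x ∈ F b⁻¹
  apply_notMem : ∀ b ∈ S, ∀ x ∈ F b, b x ∉ F b⁻¹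
  apply_ne : ∀ b ∈ S, ∀ x ∈ F b, b x ≠ x
  eq_of_mem : ∀ b ∈ S, ∀ c ∈ S, ∀ x ∈ F b, x ∈ F c → b = c

/-- `y` is obtained from `x` by undoing the last step of the history of `x`. -/
def HistStep (S : Set Homeo01) (F : Homeo01 → Set UI) (y x : UI) : Prop :=
  ∃ b ∈ S, x ∈ F b ∧ b x = y

section Words

variable {x : UI} {b : Homeo01} {l u v w : List Homeo01}

theorem act_append : act x (u ++ v) = act (act x u) v := List.foldl_append

theorem act_cons : act x (b :: l) = act (b x) l := rfl

theorem act_reverse_map_inv : act (act x w) (w.map (·⁻¹)).reverse = x := by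
  induction w generalizing x with
  | nil => rfl
  | cons b l ih =>
    rw [List.map_cons, List.reverse_cons, act_append, act_cons (l := l), ih]
    simp [act]

theorem locallyReducedAt_cons : LocallyReducedAt (b :: l) x ↔
    b x ≠ x ∧ (∀ c ∈ l.head?, c ≠ b⁻¹) ∧ LocallyReducedAt l (b x) := by
  constructor
  · rintro ⟨h1, h2⟩
    have h3 := List.isChain_cons.1 h1
    exact ⟨h2 [] b (by simp), h3.1, h3.2,
      fun u a h => h2 (b :: u) a (by simpa using h)⟩
  · rintro ⟨h1, h2, h3, h4⟩
    refine ⟨List.isChain_cons.2 ⟨h2, h3⟩, ?_⟩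
    rintro (_ | ⟨c, u⟩) a h
    · obtain rfl : a = b := by simpa using h
      exact h1
    · obtain ⟨rfl, hu⟩ := List.cons_prefix_cons.1 h
      exact h4 u a hu

theorem LocallyReducedAt.of_prefix (h : LocallyReducedAt w x) (hv : v <+: w) :
    LocallyReducedAt v x :=
  ⟨h.1.prefix hv, fun u a hu => h.2 u a (hu.trans hv)⟩

theorem locallyReducedAt_concat : LocallyReducedAt (l ++ [b]) x ↔
    LocallyReducedAt l x ∧ (∀ c ∈ l.getLast?, b ≠ c⁻¹) ∧ b (act x l) ≠ act x l := by
  constructor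
  · intro h
    refine ⟨h.of_prefix (List.prefix_append _ _), ?_, h.2 l b (List.prefix_refl _)⟩
    intro c hc
    exact (List.isChain_append.1 h.1).2.2 c hc b rfl
  · rintro ⟨h1, h2, h3⟩
    refine ⟨List.isChain_append.2 ⟨h1.1, List.isChain_singleton _, ?_⟩, fun u a h => ?_⟩
    · rintro c hc d ⟨⟩
      exact h2 c hc
    · rcases List.prefix_concat_iff.1 h with h | h
      · obtain ⟨rfl, h⟩ := List.append_inj' h rfl
        obtain rfl : a = b := by simpa using h
        exact h3
      · exact h1.2 u a h

end Words

namespace IsPingPong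

variable {S : Set Homeo01} {F : Homeo01 → Set UI} {s x : UI} {b : Homeo01}
  {l u w : List Homeo01}

/-- Accessibility of the history is invariant under the symbols. -/
theorem acc_apply (h : IsPingPong S F) (hb : b ∈ S) (hx : Acc (HistStep S F) x) :
    Acc (HistStep S F) (b x) := by
  by_cases hne : b x = x
  · rwa [hne]
  by_cases hsrc : x ∈ F b
  · exact hx.inv ⟨b, hb, hsrc, rfl⟩
  · refine ⟨_, ?_⟩
    rintro y ⟨c, hc, hxc, rfl⟩
    have := h.eq_of_mem c hc _ (h.inv_mem b hb) _ hxc (h.apply_mem b hb x hne hsrc)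
    subst this
    simpa using hx

theorem transGen_of_notMem_head (h : IsPingPong S F) (hl : ∀ c ∈ b :: l, c ∈ S)
    (hr : LocallyReducedAt (b :: l) x) (hx : x ∉ F b) :
    Relation.TransGen (HistStep S F) x (act x (b :: l)) := by
  induction l generalizing x b with
  | nil =>
    have hb := hl b (by simp)
    exact .single ⟨b⁻¹, h.inv_mem b hb,
      h.apply_mem b hb x (locallyReducedAt_cons.1 hr).1 hx, by simp [act]⟩
  | cons c l ih =>
    have hb := hl b (by simp)
    obtain ⟨h1, h2, h3⟩ := locallyReducedAt_cons.1 hr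
    have hm := h.apply_mem b hb x h1 hx
    refine .head ⟨b⁻¹, h.inv_mem b hb, hm, by simp⟩
      (ih (fun d hd => hl d (List.mem_cons_of_mem _ hd)) h3 fun hc => ?_)
    exact h2 c rfl (h.eq_of_mem c (hl c (by simp)) _ (h.inv_mem b hb) _ hc hm)

theorem transGen_of_notMem_last (h : IsPingPong S F) (hl : ∀ c ∈ l ++ [b], c ∈ S)
    (hr : LocallyReducedAt (l ++ [b]) x) (hx : act x (l ++ [b]) ∉ F b⁻¹) :
    Relation.TransGen (HistStep S F) (act x (l ++ [b])) x := by
  induction l using List.reverseRecOn generalizing b with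
  | nil =>
    have hb := hl b (by simp)
    exact .single ⟨b, hb, by_contra fun k =>
      hx (h.apply_mem b hb x (locallyReducedAt_cons.1 hr).1 k), rfl⟩
  | append_singleton l c ih =>
    have hb := hl b (by simp)
    obtain ⟨h1, h2, h3⟩ := locallyReducedAt_concat.1 hr
    rw [act_append] at hx ⊢
    have hm : act x (l ++ [c]) ∈ F b := by_contra fun k => hx (h.apply_mem b hb _ h3 k)
    refine .head ⟨b, hb, hm, rfl⟩
      (ih (fun d hd => hl d (List.mem_append_left _ hd)) h1 fun hc => ?_)
    exact h2 c (by simp) (h.eq_of_mem b hb _ (h.inv_mem c (hl c (by simp))) _ hm hc)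

theorem not_transGen_self (hs : Acc (HistStep S F) s) :
    ¬ Relation.TransGen (HistStep S F) s s := by
  have := hs.transGen
  induction this with
  | intro x _ ih => exact fun hx => ih x hx hs hx

/-- There are no nontrivial locally reduced loops at a point with accessible history. -/
theorem eq_nil_of_act_eq (h : IsPingPong S F) (hs : Acc (HistStep S F) s)
    (hl : ∀ c ∈ l, c ∈ S) (hr : LocallyReducedAt l s) (hact : act s l = s) : l = [] := by
  induction hs generalizing l with
  | intro s hacc ih =>
    have hs := Acc.intro s hacc
    rcases l with _ | ⟨b, l⟩
    · rfl
    exfalso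
    have hb := hl b (by simp)
    have hsb : s ∈ F b := by
      by_contra hsb
      have := h.transGen_of_notMem_head hl hr hsb
      rw [hact] at this
      exact not_transGen_self hs this
    rcases List.eq_nil_or_concat l with rfl | ⟨k, c, rfl⟩
    · exact h.apply_ne b hb s hsb hact
    rw [List.concat_eq_append] at *
    have hc := hl c (by simp)
    rw [← List.cons_append] at hl hr hact
    have hsc : s ∈ F c⁻¹ := by
      by_contra hsc
      have := h.transGen_of_notMem_last hl hr (by rwa [hact])
      rw [hact] at this
      exact not_transGen_self hs this
    obtain rfl : c = b⁻¹ := by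
      rw [h.eq_of_mem b hb _ (h.inv_mem c hc) s hsb hsc, inv_inv]
    obtain ⟨h1, h2, -⟩ := locallyReducedAt_concat.1 hr
    obtain ⟨-, -, h3⟩ := locallyReducedAt_cons.1 h1
    have hk : k = [] := by
      refine ih (b s) ⟨b, hb, hsb, rfl⟩ (fun d hd => hl d (by simp [hd])) h3 ?_
      rw [act_append, act_cons] at hact
      have : b⁻¹ (act (b s) k) = s := hact
      rwa [Equiv.Perm.inv_eq_iff_eq] at this
    subst hk
    exact h2 b rfl rfl

/-- Locally reduced words are geodesics. -/
theorem length_le_of_act_eq (h : IsPingPong S F) (hs : Acc (HistStep S F) s)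
    (hu : ∀ c ∈ u, c ∈ S) (hw : ∀ c ∈ w, c ∈ S) (hr : LocallyReducedAt u s)
    (hact : act s u = act s w) : u.length ≤ w.length := by
  induction w generalizing s u with
  | nil => rw [h.eq_nil_of_act_eq hs hu hr hact]
  | cons b w ih =>
    have hb := hw b (by simp)
    have hw' : ∀ c ∈ w, c ∈ S := fun c hc => hw c (by simp [hc])
    have hs' := h.acc_apply hb hs
    rw [act_cons] at hact
    rw [List.length_cons]
    by_cases hbs : b s = s
    · rw [hbs] at hact
      exact (ih hs hu hw' hr hact).trans (Nat.le_succ _)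
    by_cases hub : b ∈ u.head?
    · obtain ⟨u, rfl⟩ := List.head?_eq_some_iff.1 hub
      exact Nat.succ_le_succ (ih hs' (fun c hc => hu c (by simp [hc])) hw'
        (locallyReducedAt_cons.1 hr).2.2 hact)
    · have := ih (u := b⁻¹ :: u) hs'
        (by simpa using ⟨h.inv_mem b hb, hu⟩) hw'
        (locallyReducedAt_cons.2 ⟨by simpa using Ne.symm hbs, ?_, by simpa using hr⟩)
        (by simpa [act_cons] using hact)
      · rw [List.length_cons] at this
        omega
      · rintro c hc rfl
        exact hub (by simpa using hc)

end IsPingPong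

section Feet

variable {A : Set Homeo01} {m : Homeo01 → UI} {b : Homeo01} {x : UI}

theorem inv_notMem (hA : ∀ a ∈ A, IsPosBump a) (hb : b ∈ A) : b⁻¹ ∉ A := by
  intro hb'
  obtain ⟨t, ht⟩ := (hA b hb).1.2.nonempty
  have h1 := (hA b hb).2 t ht
  have h2 := (hA _ hb').2 (b t) (by simpa [supt] using Ne.symm ht)
  exact lt_asymm h1 (by simpa using h2)

theorem symSrc_inv (hA : ∀ a ∈ A, IsPosBump a) (hb : b ∈ A ∨ b⁻¹ ∈ A) :
    symSrc A m b⁻¹ = symDest A m b := by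
  unfold symSrc symDest
  by_cases h : b ∈ A
  · rw [if_neg (inv_notMem hA h), if_pos h, inv_inv]
  · rw [if_neg h, if_pos (hb.resolve_left h)]

theorem apply_mem_dest (hm : IsPosBump b) {t : UI} (hx : b x ≠ x) (h : x ∉ src b t) :
    b x ∈ dest b t :=
  ⟨fun k => hx (b.injective k), hm.1.1 (not_lt.1 fun k => h ⟨hx, k⟩)⟩

theorem apply_notMem_dest (hm : IsPosBump b) {t : UI} (h : x ∈ src b t) : b x ∉ dest b t :=
  fun k => (hm.1.1.strictMono_of_injective b.injective h.2).not_ge k.2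

theorem isPingPong_symSrc (hA : ∀ a ∈ A, IsPosBump a) (hfd : FeetDisjoint A m) :
    IsPingPong {b | b ∈ A ∨ b⁻¹ ∈ A} (symSrc A m) where
  inv_mem b hb := by simpa using hb.symm
  apply_mem b hb x hx hsrc := by
    by_cases h : b ∈ A
    · rw [symSrc_inv hA hb, symDest, if_pos h]
      rw [symSrc, if_pos h] at hsrc
      exact apply_mem_dest (hA b h) hx hsrc
    · have h' := hb.resolve_left h
      rw [symSrc, if_pos h']
      rw [symSrc, if_neg h] at hsrc
      by_contra k
      exact hsrc (by simpa using apply_mem_dest (x := b x) (hA _ h') (by simpa using hx.symm) k)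
  apply_notMem b hb x hx := by
    by_cases h : b ∈ A
    · rw [symSrc_inv hA hb, symDest, if_pos h]
      rw [symSrc, if_pos h] at hx
      exact apply_notMem_dest (hA b h) hx
    · have h' := hb.resolve_left h
      rw [symSrc, if_pos h']
      rw [symSrc, if_neg h] at hx
      exact fun k => apply_notMem_dest (hA _ h') k (by simpa using hx)
  apply_ne b hb x hx := by
    unfold symSrc at hx
    split_ifs at hx
    · exact hx.1
    · exact fun k => hx.1 (by rw [Equiv.Perm.inv_eq_iff_eq, k])
  eq_of_mem b hb c hc x hxb hxc := by
    have key : ∀ b, b ∈ A ∨ b⁻¹ ∈ A → x ∈ symSrc A m b →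
        ∃ a ∈ A, ∃ i, x ∈ foot a (m a) i ∧ b = if i then a⁻¹ else a := by
      intro b hb hx
      by_cases h : b ∈ A
      · rw [symSrc, if_pos h] at hx
        exact ⟨b, h, false, hx, rfl⟩
      · rw [symSrc, if_neg h] at hx
        exact ⟨b⁻¹, hb.resolve_left h, true, hx, by simp⟩
    obtain ⟨a, ha, i, hi, rfl⟩ := key b hb hxb
    obtain ⟨a', ha', j, hj, rfl⟩ := key c hc hxc
    by_contra hne
    refine Set.disjoint_left.1 (hfd a ha a' ha' i j fun e => hne ?_) hi hj
    obtain ⟨rfl, rfl⟩ := Prod.mk.inj e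
    rfl

theorem FiniteHistory.acc (hA : ∀ a ∈ A, IsPosBump a) (hfd : FeetDisjoint A m)
    (hx : FiniteHistory A m x) : Acc (HistStep {b | b ∈ A ∨ b⁻¹ ∈ A} (symSrc A m)) x := by
  obtain ⟨n, hn⟩ := hx
  have hP := isPingPong_symSrc hA hfd
  have key : ∀ (k : ℕ) (w : List Homeo01), w.length + k = n + 1 → WordOn A w →
      LocallyReducedAt w x → act x w ∉ wordDest A m w →
      Acc (HistStep {b | b ∈ A ∨ b⁻¹ ∈ A} (symSrc A m)) (act x w) := by
    intro k
    induction k with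
    | zero =>
      intro w hk h1 h2 h3
      have := hn w h1 h2 h3
      omega
    | succ k ih =>
      intro w hk h1 h2 h3
      refine ⟨_, ?_⟩
      rintro y ⟨b, hb, hxb, rfl⟩
      have hact : act x (w ++ [b]) = b (act x w) := act_append
      rw [← hact]
      refine ih (w ++ [b]) (by simp; omega) ?_ (locallyReducedAt_concat.2 ⟨h2, ?_, ?_⟩) ?_
      · intro c hc
        rcases List.mem_append.1 hc with hc | hc
        · exact h1 c hc
        · rw [List.mem_singleton.1 hc]
          exact hb
      · rintro c hc rfl
        have hc' : w.getLast? = some c := hc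
        have hcA := h1 c (List.mem_of_getLast? hc')
        rw [symSrc_inv hA hcA] at hxb
        simp only [wordDest, hc'] at h3
        exact h3 hxb
      · exact hP.apply_ne b hb _ hxb
      · have := hP.apply_notMem b hb _ hxb
        rw [symSrc_inv hA hb] at this
        simpa [wordDest, hact] using this
  exact key (n + 1) [] (by simp) (by simp [WordOn])
    ⟨List.isChain_nil, fun u a h => by simp at h⟩ (by simp [wordDest])

end Feet

/-- **Lemma (NoReturn).** For a geometrically fast marked set `A` of positive bumps:
if `s` has finite history, `u` is an `A`-word locally reduced at `s` and `w` is an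
`A`-word shorter than `u`, then `uw` has no return prefix for `s`. -/
theorem no_return (A : Set Homeo01) (m : Homeo01 → UI)
    (hA : ∀ a ∈ A, IsPosBump a) (hm : IsMarking A m) (hfd : FeetDisjoint A m)
    (s : UI) (hs : FiniteHistory A m s)
    (u w : List Homeo01) (hu : WordOn A u) (hw : WordOn A w)
    (hlr : LocallyReducedAt u s) (hlen : w.length < u.length) :
    ¬ HasReturnPrefix s (u ++ w) := by
  have hP := isPingPong_symSrc hA hfd
  have hacc := hs.acc hA hfd
  rintro ⟨v, hv, hne, hact⟩
  have hsplit : v <+: u ∨ ∃ w', v = u ++ w' ∧ w' <+: w := by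
    rcases List.prefix_or_prefix_of_prefix hv (List.prefix_append u w) with h | ⟨w', rfl⟩
    · exact .inl h
    · exact .inr ⟨w', rfl, (List.prefix_append_right_inj u).1 hv⟩
  rcases hsplit with hv | ⟨w', rfl, hw'⟩
  · exact hne (hP.eq_nil_of_act_eq hacc (fun c hc => hu c (hv.subset hc))
      (hlr.of_prefix hv) hact)
  · rw [act_append] at hact
    have hback : act s (w'.map (·⁻¹)).reverse = act s u := by
      conv_lhs => rw [← hact]
      exact act_reverse_map_inv
    have := hP.length_le_of_act_eq hacc hu (fun c hc => ?_) hlr hback.symm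
    · rw [List.length_reverse, List.length_map] at this
      have := hw'.length_le
      omega
    · obtain ⟨d, hd, rfl⟩ := List.mem_map.1 (List.mem_reverse.1 hc)
      exact hP.inv_mem d (hw d (hw'.subset hd))

end PingPong
end

section
/- Let X ⊆ Homeo₊(I) be a (possibly infinite) geometrically fast set equipped with a marking of its used bumps witnessing fastness, and let E be a set of bumps which is extraneous in X. Then the map g ↦ g/E extends to a group isomorphism from ⟨X⟩ onto ⟨X/E⟩. -/
open Set

namespace PingPong

/-! ### Supports and bumps -/

theorem apply_mem_supt_iff {f : Homeo01} {t : UI} : f t ∈ supt f ↔ t ∈ supt f :=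
  not_congr f.injective.eq_iff

theorem supt_inv (f : Homeo01) : supt f⁻¹ = supt f := by
  ext t
  refine not_congr ?_
  rw [Equiv.Perm.inv_eq_iff_eq, eq_comm]

theorem inv_apply_mem_supt_iff {f : Homeo01} {t : UI} : f⁻¹ t ∈ supt f ↔ t ∈ supt f := by
  have := @apply_mem_supt_iff f⁻¹ t
  rwa [supt_inv] at this

theorem zpow_apply_mem_supt {f : Homeo01} {t : UI} (ht : t ∈ supt f) (n : ℤ) :
    (f ^ n) t ∈ supt f := fun h => ht <| by
  rw [← Equiv.Perm.mul_apply, ← zpow_one_add, add_comm, zpow_add_one, Equiv.Perm.mul_apply] at h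
  exact (f ^ n).injective h

theorem IsOPH.strictMono {f : Homeo01} (hf : IsOPH f) : StrictMono f :=
  Monotone.strictMono_of_injective hf f.injective

theorem IsOPH.lt_iff {f : Homeo01} (hf : IsOPH f) {s t : UI} : f s < f t ↔ s < t :=
  hf.strictMono.lt_iff_lt

theorem IsOPH.le_iff {f : Homeo01} (hf : IsOPH f) {s t : UI} : f s ≤ f t ↔ s ≤ t :=
  hf.strictMono.le_iff_le

theorem IsOPH.inv {f : Homeo01} (hf : IsOPH f) : IsOPH f⁻¹ := fun s t hst => by
  rw [← hf.le_iff]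
  simpa using hst

namespace IsPosBump

variable {a : Homeo01}

theorem isOPH (ha : IsPosBump a) : IsOPH a := ha.1.1

theorem ordConnected (ha : IsPosBump a) : (supt a).OrdConnected :=
  ha.1.2.isPreconnected.ordConnected

theorem lt_apply (ha : IsPosBump a) {t : UI} (ht : t ∈ supt a) : t < a t := ha.2 t ht

theorem inv_apply_lt (ha : IsPosBump a) {t : UI} (ht : t ∈ supt a) : a⁻¹ t < t := by
  simpa using ha.lt_apply (inv_apply_mem_supt_iff.2 ht)

theorem strictMono_zpow (ha : IsPosBump a) {t : UI} (ht : t ∈ supt a) :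
    StrictMono fun n : ℤ => (a ^ n) t := by
  refine strictMono_int_of_lt_succ fun n => ?_
  rw [add_comm, zpow_one_add, Equiv.Perm.mul_apply]
  exact ha.lt_apply (zpow_apply_mem_supt ht n)

end IsPosBump

/-- The symbol `c` or `c⁻¹`, according to the sign. -/
def signed (c : Homeo01) (σ : Bool) : Homeo01 := cond σ c c⁻¹

theorem signed_not (c : Homeo01) (σ : Bool) : signed c (!σ) = (signed c σ)⁻¹ := by
  cases σ <;> simp [signed]

theorem inv_apply_eq_of_eqOn {f a : Homeo01} {S : Set UI} (h : EqOn f a S) {t : UI}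
    (ht : a⁻¹ t ∈ S) : f⁻¹ t = a⁻¹ t := by
  rw [Equiv.Perm.inv_eq_iff_eq, h ht]
  simp

/-- On the support of a used bump, each power of sign `±1` agrees with the bump up to sign. -/
theorem UsedIn.exists_signed {f a : Homeo01} (h : UsedIn f a) (τ : Bool) :
    ∃ σ, EqOn (signed f τ) (signed a σ) (supt a) := by
  obtain ⟨-, h | h⟩ := h
  · cases τ
    · exact ⟨false, fun t ht => inv_apply_eq_of_eqOn h (inv_apply_mem_supt_iff.2 ht)⟩
    · exact ⟨true, h⟩
  · cases τ
    · refine ⟨true, fun t ht => ?_⟩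
      have := inv_apply_eq_of_eqOn (t := t) h (by simpa using apply_mem_supt_iff.2 ht)
      simpa [signed] using this
    · exact ⟨false, h⟩

theorem UsedIn.exists_zpow {f a : Homeo01} (h : UsedIn f a) :
    ∃ ε : ℤ, (ε = 1 ∨ ε = -1) ∧ ∀ t ∈ supt a, ∀ n : ℤ, (f ^ n) t = (a ^ (ε * n)) t := by
  have key : ∀ b : Homeo01, EqOn f b (supt b) → ∀ t ∈ supt b, ∀ n : ℤ, (f ^ n) t = (b ^ n) t := by
    intro b hb t ht n
    induction n with
    | zero => simp
    | succ n ih =>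
      rw [add_comm, zpow_one_add, zpow_one_add, Equiv.Perm.mul_apply, Equiv.Perm.mul_apply, ih,
        hb (zpow_apply_mem_supt ht _)]
    | pred n ih =>
      rw [sub_eq_neg_add, zpow_add, zpow_add, Equiv.Perm.mul_apply, Equiv.Perm.mul_apply, ih,
        zpow_neg_one, zpow_neg_one, inv_apply_eq_of_eqOn hb]
      exact inv_apply_mem_supt_iff.2 (zpow_apply_mem_supt ht _)
  obtain ⟨-, h | h⟩ := h
  · exact ⟨1, Or.inl rfl, by simpa using key a h⟩
  · refine ⟨-1, Or.inr rfl, fun t ht n => ?_⟩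
    rw [key a⁻¹ (by rwa [supt_inv]) t (by rwa [supt_inv])]
    simp

theorem UsedIn.apply_mem_iff {f a : Homeo01} (h : UsedIn f a) {t : UI} :
    f t ∈ supt a ↔ t ∈ supt a := by
  obtain ⟨σ, h1⟩ := h.exists_signed true
  obtain ⟨ρ, h2⟩ := h.exists_signed false
  have key : ∀ (σ : Bool) {s : UI}, s ∈ supt a → signed a σ s ∈ supt a := by
    rintro (- | -) s hs
    exacts [inv_apply_mem_supt_iff.2 hs, apply_mem_supt_iff.2 hs]
  refine ⟨fun ht => ?_, fun ht => ?_⟩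
  · have := key ρ ht
    rw [← h2 ht] at this
    simpa [signed] using this
  · have := key σ ht
    rwa [← h1 ht] at this

open Classical in
/-- The restriction of a permutation to an invariant set, extended by the identity. -/
noncomputable def restrict (f : Homeo01) (S : Set UI) (h : ∀ t, f t ∈ S ↔ t ∈ S) : Homeo01 :=
  Equiv.Perm.ofSubtype (f.subtypePerm h)

theorem restrict_apply_of_mem {f : Homeo01} {S : Set UI} (h : ∀ t, f t ∈ S ↔ t ∈ S) {t : UI}
    (ht : t ∈ S) : restrict f S h t = f t := by
  classical
  rw [restrict, Equiv.Perm.ofSubtype_apply_of_mem _ ht, Equiv.Perm.subtypePerm_apply]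

theorem restrict_apply_of_notMem {f : Homeo01} {S : Set UI} (h : ∀ t, f t ∈ S ↔ t ∈ S) {t : UI}
    (ht : t ∉ S) : restrict f S h t = t := by
  classical
  exact Equiv.Perm.ofSubtype_apply_of_not_mem _ ht

theorem exists_usedIn_of_lt {f : Homeo01} (hf : IsOPH f) {q : UI} (hq : q < f q) :
    ∃ c, IsPosBump c ∧ EqOn f c (supt c) ∧ q ∈ supt c := by
  set S : Set UI := {r | ∀ s ∈ uIcc q r, s < f s} with hSdef
  have hqS : q ∈ S := by
    intro s hs
    rw [uIcc_self] at hs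
    obtain rfl : s = q := hs
    exact hq
  have hself : ∀ r ∈ S, r < f r := fun r hr => hr r right_mem_uIcc
  have hS : S.OrdConnected := by
    refine ⟨fun r hr t ht u hu s hs => ?_⟩
    by_cases h : s ∈ uIcc q r
    · exact hr s h
    · refine ht s ?_
      simp only [mem_uIcc, mem_Icc] at *
      grind
  have hmaps : ∀ t, f t ∈ S ↔ t ∈ S := by
    have hstep : ∀ t, t < f t → ∀ s ∈ Icc t (f t), s < f s := fun t ht s hs => by
      rcases hs.2.eq_or_lt with rfl | h
      · exact hf.lt_iff.2 ht
      · exact h.trans_le (hf hs.1)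
    refine fun t => ⟨fun ht s hs => ?_, fun ht s hs => ?_⟩
    · have h1 : t < f t := hf.lt_iff.1 (hself _ ht)
      by_cases h2 : s ∈ Icc t (f t)
      · exact hstep t h1 s h2
      · refine ht s ?_
        simp only [mem_uIcc, mem_Icc, not_and_or, not_le] at *
        grind
    · have h1 := hself t ht
      by_cases h2 : s ∈ Icc t (f t)
      · exact hstep t h1 s h2
      · refine ht s ?_
        simp only [mem_uIcc, mem_Icc, not_and_or, not_le] at *
        grind
  have hsupp : supt (restrict f S hmaps) = S := by
    ext t
    by_cases ht : t ∈ S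
    · simp [supt, restrict_apply_of_mem hmaps ht, ht, (hself t ht).ne']
    · simp [supt, restrict_apply_of_notMem hmaps ht, ht]
  refine ⟨restrict f S hmaps, ⟨⟨fun s t hst => ?_, ?_⟩, fun t ht => ?_⟩, ?_, ?_⟩
  · by_cases hs : s ∈ S <;> by_cases ht : t ∈ S
    · rw [restrict_apply_of_mem hmaps hs, restrict_apply_of_mem hmaps ht]
      exact hf hst
    · rw [restrict_apply_of_mem hmaps hs, restrict_apply_of_notMem hmaps ht]
      by_contra! h
      exact ht (hS.out hs ((hmaps s).2 hs) ⟨hst, h.le⟩)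
    · rw [restrict_apply_of_notMem hmaps hs, restrict_apply_of_mem hmaps ht]
      exact hst.trans (hself t ht).le
    · rwa [restrict_apply_of_notMem hmaps hs, restrict_apply_of_notMem hmaps ht]
  · rw [hsupp]
    exact ⟨⟨q, hqS⟩, hS.isPreconnected⟩
  · rw [hsupp] at ht
    rw [restrict_apply_of_mem hmaps ht]
    exact hself t ht
  · rw [hsupp]
    exact fun t ht => (restrict_apply_of_mem hmaps ht).symm
  · rwa [hsupp]

/-- Each moved point lies in the support of a used bump. -/
theorem exists_usedIn {f : Homeo01} (hf : IsOPH f) {q : UI} (hq : q ∈ supt f) :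
    ∃ c, UsedIn f c ∧ q ∈ supt c := by
  rcases lt_or_gt_of_ne hq with h | h
  · have h' : q < f⁻¹ q := hf.lt_iff.1 (by simpa using h)
    obtain ⟨c, hc, hfc, hqc⟩ := exists_usedIn_of_lt hf.inv h'
    refine ⟨c, ⟨hc, Or.inr fun t ht => ?_⟩, hqc⟩
    have := inv_apply_eq_of_eqOn hfc (inv_apply_mem_supt_iff.2 ht)
    rwa [inv_inv] at this
  · obtain ⟨c, hc, hfc, hqc⟩ := exists_usedIn_of_lt hf h
    exact ⟨c, ⟨hc, Or.inl hfc⟩, hqc⟩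

/-! ### Feet -/

theorem foot_subset_supt (c : Homeo01) (t : UI) (σ : Bool) : foot c t σ ⊆ supt c := by
  cases σ <;> exact fun s hs => hs.1

namespace IsPosBump

variable {c : Homeo01} {t : UI}

theorem foot_nonempty (hc : IsPosBump c) (ht : t ∈ supt c) (σ : Bool) : (foot c t σ).Nonempty := by
  cases σ
  · exact ⟨c⁻¹ t, inv_apply_mem_supt_iff.2 ht, hc.inv_apply_lt ht⟩
  · exact ⟨c t, apply_mem_supt_iff.2 ht, le_rfl⟩

theorem foot_ordConnected (hc : IsPosBump c) (σ : Bool) : (foot c t σ).OrdConnected := by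
  cases σ
  · exact ⟨fun r hr s hs u hu => ⟨hc.ordConnected.out hr.1 hs.1 hu, hu.2.trans_lt hs.2⟩⟩
  · exact ⟨fun r hr s hs u hu => ⟨hc.ordConnected.out hr.1 hs.1 hu, hr.2.trans hu.1⟩⟩

/-- A signed bump moves the part of its support outside its source into its destination. -/
theorem signed_mem_foot (hc : IsPosBump c) {σ : Bool} {s : UI} (hs : s ∈ supt c)
    (h : s ∉ foot c t (!σ)) : signed c σ s ∈ foot c t σ := by
  cases σ
  · refine ⟨inv_apply_mem_supt_iff.2 hs, ?_⟩
    by_contra! h1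
    refine h ⟨hs, ?_⟩
    have := hc.isOPH h1
    simpa [signed] using this
  · refine ⟨apply_mem_supt_iff.2 hs, ?_⟩
    by_contra! h1
    exact h ⟨hs, hc.isOPH.lt_iff.1 h1⟩

/-- A convex set meeting the support of a bump but not its feet lies in the support. -/
theorem subset_supt_of_disjoint_feet (hc : IsPosBump c) (ht : t ∈ supt c) {F : Set UI}
    (hF : F.OrdConnected) (hd : ∀ σ, Disjoint (foot c t σ) F) {q : UI} (hqF : q ∈ F)
    (hq : q ∈ supt c) : F ⊆ supt c := by
  intro r hr
  by_contra hrc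
  have ho := hc.ordConnected
  have hout : ∀ s ∈ supt c, (r < q → r < s) ∧ (q ≤ r → s < r) := fun s hs => by
    constructor
    · intro h
      by_contra! h1
      exact hrc (ho.out hs hq ⟨h1, h.le⟩)
    · intro h
      by_contra! h1
      exact hrc (ho.out hq hs ⟨h, h1⟩)
  rcases lt_or_ge r q with h | h
  · have hmin : min q t ∈ supt c := by rcases min_choice q t with h | h <;> rwa [h]
    have hs : c⁻¹ (min q t) ∈ supt c := inv_apply_mem_supt_iff.2 hmin
    have hlt := hc.inv_apply_lt hmin
    exact (hd false).le_bot ⟨⟨hs, hlt.trans_le (min_le_right _ _)⟩,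
      hF.out hr hqF ⟨((hout _ hs).1 h).le, hlt.le.trans (min_le_left _ _)⟩⟩
  · have hmax : max q t ∈ supt c := by rcases max_choice q t with h | h <;> rwa [h]
    have hs : c (max q t) ∈ supt c := apply_mem_supt_iff.2 hmax
    have hlt := hc.lt_apply hmax
    exact (hd true).le_bot ⟨⟨hs, hc.isOPH (le_max_right _ _)⟩,
      hF.out hqF hr ⟨(le_max_left _ _).trans hlt.le, ((hout _ hs).2 h).le⟩⟩

theorem sInf_notMem (hc : IsPosBump c) : sInf (supt c) ∉ supt c := fun h =>
  (hc.inv_apply_lt h).not_ge (sInf_le (inv_apply_mem_supt_iff.2 h))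

theorem sSup_notMem (hc : IsPosBump c) : sSup (supt c) ∉ supt c := fun h =>
  (hc.lt_apply h).not_ge (le_sSup (apply_mem_supt_iff.2 h))

theorem isLeftTransition_sInf (hc : IsPosBump c) : IsLeftTransition c (sInf (supt c)) := by
  refine ⟨hc.sInf_notMem, fun ε hε => ?_⟩
  by_contra! h
  have hle : ∀ s ∈ supt c, ((sInf (supt c) : UI) : ℝ) + ε ≤ s := fun s hs =>
    h s hs ((sInf_le hs).lt_of_ne fun h => hc.sInf_notMem (h ▸ hs))
  obtain ⟨s, hs⟩ := hc.1.2.nonempty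
  have h1 := (sInf (supt c)).2.1
  let y : UI := ⟨((sInf (supt c) : UI) : ℝ) + ε, by linarith, (hle s hs).trans s.2.2⟩
  have h2 : y ≤ sInf (supt c) := le_sInf fun s hs => hle s hs
  have h3 : ((sInf (supt c) : UI) : ℝ) + ε ≤ (sInf (supt c) : UI) := h2
  linarith

theorem isRightTransition_sSup (hc : IsPosBump c) : IsRightTransition c (sSup (supt c)) := by
  refine ⟨hc.sSup_notMem, fun ε hε => ?_⟩
  by_contra! h
  have hle : ∀ s ∈ supt c, (s : ℝ) ≤ ((sSup (supt c) : UI) : ℝ) - ε := fun s hs =>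
    h s hs ((le_sSup hs).lt_of_ne fun h => hc.sSup_notMem (h ▸ hs))
  obtain ⟨s, hs⟩ := hc.1.2.nonempty
  have h1 := (sSup (supt c)).2.2
  let y : UI := ⟨((sSup (supt c) : UI) : ℝ) - ε, s.2.1.trans (hle s hs), by linarith⟩
  have h2 : sSup (supt c) ≤ y := sSup_le fun s hs => hle s hs
  have h3 : ((sSup (supt c) : UI) : ℝ) ≤ ((sSup (supt c) : UI) : ℝ) - ε := h2
  linarith

end IsPosBump

/-- The support of an isolated bump is disjoint from the feet of the other bumps. -/
theorem IsolatedIn.disjoint_foot {A : Set Homeo01} {m : Homeo01 → UI}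
    (hA : ∀ a ∈ A, IsPosBump a) (hm : IsMarking A m) (hfd : FeetDisjoint A m) {e b : Homeo01}
    (he : e ∈ A) (hiso : IsolatedIn A e) (hb : b ∈ A) (hbe : b ≠ e) (τ : Bool) :
    Disjoint (foot b (m b) τ) (supt e) := by
  rw [Set.disjoint_left]
  intro q hqb hqe
  have hsub : foot b (m b) τ ⊆ supt e :=
    (hA e he).subset_supt_of_disjoint_feet (hm e he) ((hA b hb).foot_ordConnected τ)
      (fun σ => hfd e he b hb σ τ fun h => hbe (congrArg Prod.fst h).symm) hqb hqe
  have hdis : ∀ r, r ∈ foot b (m b) τ → r ∉ foot e (m e) τ := fun r hr hr' =>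
    (hfd b hb e he τ τ fun h => hbe (congrArg Prod.fst h)).le_bot ⟨hr, hr'⟩
  have ho := (hA e he).ordConnected
  obtain ⟨s, hs⟩ := (hA e he).foot_nonempty (hm e he) τ
  cases τ
  · have hx : sInf (supt b) ∉ supt e := fun h =>
      hiso _ h b hb (Or.inl (hA b hb).isLeftTransition_sInf)
    have hlt : ∀ s ∈ supt e, sInf (supt b) < s := fun s hs => by
      by_contra! h
      exact hx (ho.out hs hqe ⟨h, sInf_le hqb.1⟩)
    have hltm : sInf (supt b) < m b := (sInf_le (hm b hb)).lt_of_ne fun h =>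
      (hA b hb).sInf_notMem (h ▸ hm b hb)
    obtain ⟨r, hr, hrs⟩ := sInf_lt_iff.1 (lt_min (hlt s hs.1) hltm)
    have hrb : r ∈ foot b (m b) false := ⟨hr, hrs.trans_le (min_le_right _ _)⟩
    exact hdis r hrb ⟨hsub hrb, (hrs.trans_le (min_le_left _ _)).trans hs.2⟩
  · have hx : sSup (supt b) ∉ supt e := fun h =>
      hiso _ h b hb (Or.inr (hA b hb).isRightTransition_sSup)
    have hlt : ∀ s ∈ supt e, s < sSup (supt b) := fun s hs => by
      by_contra! h
      exact hx (ho.out hqe hs ⟨le_sSup hqb.1, h⟩)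
    have hmb : b (m b) ∈ supt b := apply_mem_supt_iff.2 (hm b hb)
    have hltm : b (m b) < sSup (supt b) := (le_sSup hmb).lt_of_ne fun h =>
      (hA b hb).sSup_notMem (h ▸ hmb)
    obtain ⟨r, hr, hrs⟩ := lt_sSup_iff.1 (max_lt (hlt s hs.1) hltm)
    have hrb : r ∈ foot b (m b) true := ⟨hr, (le_max_right _ _).trans hrs.le⟩
    exact hdis r hrb ⟨hsub hrb, hs.2.trans ((le_max_left _ _).trans hrs.le)⟩

/-! ### Stacks of signed bumps -/

/-- `Stack A m E J Φ c σ` says that `Φ` is a product of signed bumps with bumps in `A \ E` and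
last factor `c` with sign `σ`, which moves the set `J` from foot to foot. -/
inductive Stack (A : Set Homeo01) (m : Homeo01 → UI) (E : Set Homeo01) (J : Set UI) :
    Homeo01 → Homeo01 → Bool → Prop
  | single (c : Homeo01) (σ : Bool) : c ∈ A → c ∉ E → J ⊆ supt c →
      (∀ ρ, Disjoint (foot c (m c) ρ) J) → Stack A m E J (signed c σ) c σ
  | cons (Φ b c : Homeo01) (τ σ : Bool) : Stack A m E J Φ b τ → c ∈ A → c ∉ E →
      (b, τ) ≠ (c, !σ) → foot b (m b) τ ⊆ supt c → Stack A m E J (signed c σ * Φ) c σ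

namespace Stack

variable {A : Set Homeo01} {m : Homeo01 → UI} {E : Set Homeo01} {J : Set UI}
  {Φ c : Homeo01} {σ : Bool}

theorem mem (h : Stack A m E J Φ c σ) : c ∈ A := by
  cases h <;> assumption

theorem notMem (h : Stack A m E J Φ c σ) : c ∉ E := by
  cases h <;> assumption

theorem apply_mem_foot (hA : ∀ a ∈ A, IsPosBump a) (hfd : FeetDisjoint A m)
    (h : Stack A m E J Φ c σ) {p : UI} (hp : p ∈ J) : Φ p ∈ foot c (m c) σ := by
  induction h with
  | single c σ hc _ hJ hd =>
    exact (hA c hc).signed_mem_foot (hJ hp) fun h => (hd _).le_bot ⟨h, hp⟩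
  | cons Φ b c τ σ hs hc _ hne hsub ih =>
    exact (hA c hc).signed_mem_foot (hsub ih) fun h =>
      (hfd b hs.mem c hc τ (!σ) hne).le_bot ⟨ih, h⟩

theorem pop (h : Stack A m E J Φ c σ) :
    signed c (!σ) * Φ = 1 ∨ ∃ b τ, Stack A m E J (signed c (!σ) * Φ) b τ := by
  cases h with
  | single => exact Or.inl (by rw [signed_not, inv_mul_cancel])
  | cons Φ b _ τ _ hs => exact Or.inr ⟨b, τ, by rwa [signed_not, inv_mul_cancel_left]⟩

end Stack

/-! ### Excision data -/

/-- The bumps in `E` are isolated bumps used in `f ∈ X`, with supports contained in an interval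
`J` which is disjoint from the feet of the other elements of `X`. -/
structure ExcisionData (X : Set Homeo01) (m : Homeo01 → UI) (E : Set Homeo01) (J : Set UI)
    (f : Homeo01) : Prop where
  isOPH : ∀ g ∈ X, IsOPH g
  isMarking : IsMarking (usedBumps X) m
  feetDisjoint : FeetDisjoint (usedBumps X) m
  ordConnected : J.OrdConnected
  mem : f ∈ X
  usedIn : ∀ e ∈ E, UsedIn f e
  isolatedIn : ∀ e ∈ E, IsolatedIn (usedBumps X) e
  supt_subset : ∀ e ∈ E, supt e ⊆ J
  disjoint : ∀ g ∈ X, g ≠ f → ∀ b, UsedIn g b → ∀ σ, Disjoint (foot b (m b) σ) J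

/-- The union of the supports of the elements of `E`. -/
def unionSupt (E : Set Homeo01) : Set UI := {t | ∃ e ∈ E, t ∈ supt e}

/-- The evaluation of a word under an assignment of permutations to letters. -/
def evalWord {X : Set Homeo01} (F : X → Homeo01) (L : List (X × Bool)) : Homeo01 :=
  (L.map fun x => signed (F x.1) x.2).prod

theorem evalWord_cons {X : Set Homeo01} (F : X → Homeo01) (x : X × Bool) (L : List (X × Bool))
    (t : UI) : evalWord F (x :: L) t = signed (F x.1) x.2 (evalWord F L t) := by
  simp [evalWord]

theorem isPosBump_of_mem_usedBumps {X : Set Homeo01} : ∀ a ∈ usedBumps X, IsPosBump a :=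
  fun _ ⟨_, _, h⟩ => h.1

namespace ExcisionData

variable {X : Set Homeo01} {m : Homeo01 → UI} {E : Set Homeo01} {J : Set UI} {f : Homeo01}

theorem mem_usedBumps (D : ExcisionData X m E J f) {e : Homeo01} (he : e ∈ E) :
    e ∈ usedBumps X := ⟨f, D.mem, D.usedIn e he⟩

theorem unionSupt_subset (D : ExcisionData X m E J f) : unionSupt E ⊆ J :=
  fun _ ⟨e, he, ht⟩ => D.supt_subset e he ht

theorem notMem_of_usedIn (D : ExcisionData X m E J f) {g c : Homeo01} (hg : g ∈ X)
    (hgf : g ≠ f) (hc : UsedIn g c) : c ∉ E := fun hcE => by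
  obtain ⟨s, hs⟩ := hc.1.foot_nonempty (D.isMarking c ⟨g, hg, hc⟩) true
  exact (D.disjoint g hg hgf c hc true).le_bot
    ⟨hs, D.supt_subset c hcE (foot_subset_supt _ _ _ hs)⟩

theorem notMem_unionSupt_of_mem_foot (D : ExcisionData X m E J f) {b : Homeo01}
    (hb : b ∈ usedBumps X) (hbE : b ∉ E) {τ : Bool} {t : UI} (ht : t ∈ foot b (m b) τ) :
    t ∉ unionSupt E := fun ⟨e, he, hte⟩ =>
  ((D.isolatedIn e he).disjoint_foot isPosBump_of_mem_usedBumps D.isMarking D.feetDisjoint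
    (D.mem_usedBumps he) hb (fun h => hbE (h ▸ he)) τ).le_bot ⟨ht, hte⟩

theorem apply_mem_unionSupt_iff (D : ExcisionData X m E J f) (t : UI) :
    f t ∈ unionSupt E ↔ t ∈ unionSupt E :=
  exists_congr fun e => and_congr_right fun he => (D.usedIn e he).apply_mem_iff

theorem zpow_apply_mem_unionSupt (D : ExcisionData X m E J f) {t : UI} (ht : t ∈ unionSupt E)
    (n : ℤ) : (f ^ n) t ∈ unionSupt E := by
  obtain ⟨e, he, hte⟩ := ht
  obtain ⟨ε, -, h⟩ := (D.usedIn e he).exists_zpow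
  exact ⟨e, he, by rw [h t hte]; exact zpow_apply_mem_supt hte _⟩

theorem quotSupp_self (D : ExcisionData X m E J f) : quotSupp f E = unionSupt E :=
  Set.ext fun _ => exists_congr fun e => and_congr_right fun he =>
    and_iff_right (D.usedIn e he)

theorem quotSupp_eq_empty (D : ExcisionData X m E J f) {g : Homeo01} (hg : g ∈ X)
    (hgf : g ≠ f) : quotSupp g E = ∅ :=
  Set.eq_empty_of_forall_notMem fun _ ⟨_, he, hge, _⟩ => D.notMem_of_usedIn hg hgf hge he

theorem quot_eq (D : ExcisionData X m E J f) {g g' : Homeo01} (hg : g ∈ X) (hgf : g ≠ f)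
    (h : IsQuot g E g') : g' = g :=
  Equiv.ext fun t => h.2 t (by simp [D.quotSupp_eq_empty hg hgf])

theorem exists_isQuot (D : ExcisionData X m E J f) {g : Homeo01} (hg : g ∈ X) :
    ∃ g', IsQuot g E g' := by
  by_cases hgf : g = f
  · subst hgf
    have h : ∀ t, g t ∈ (unionSupt E)ᶜ ↔ t ∈ (unionSupt E)ᶜ := fun t =>
      not_congr (D.apply_mem_unionSupt_iff t)
    refine ⟨restrict g _ h, fun t ht => ?_, fun t ht => ?_⟩
    · rw [D.quotSupp_self] at ht
      exact restrict_apply_of_notMem h (by simpa using ht)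
    · rw [D.quotSupp_self] at ht
      exact restrict_apply_of_mem h ht
  · exact ⟨g, by simp [D.quotSupp_eq_empty hg hgf], fun t _ => rfl⟩

/-- On the supports of the excised bumps, the quotient of `f` is trivial. -/
theorem signed_quot_apply_of_mem (D : ExcisionData X m E J f) {f' : Homeo01}
    (h : IsQuot f E f') {t : UI} (ht : t ∈ unionSupt E) (σ : Bool) : signed f' σ t = t := by
  have h1 : f' t = t := h.1 t (by rwa [D.quotSupp_self])
  cases σ
  · exact Equiv.Perm.inv_eq_iff_eq.2 h1.symm
  · exact h1

/-- Off the supports of the excised bumps, elements of `X` agree with their quotients. -/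
theorem signed_quot_apply_of_notMem (D : ExcisionData X m E J f) {g g' : Homeo01} (hg : g ∈ X)
    (h : IsQuot g E g') {t : UI} (ht : t ∉ unionSupt E) (σ : Bool) :
    signed g' σ t = signed g σ t := by
  by_cases hgf : g = f
  · subst hgf
    have h1 : EqOn g' g (unionSupt E)ᶜ := fun s hs => h.2 s (by rwa [D.quotSupp_self])
    cases σ
    · refine inv_apply_eq_of_eqOn h1 fun h2 => ht ?_
      rw [← D.apply_mem_unionSupt_iff] at h2
      simpa using h2
    · exact h1 ht
  · rw [D.quot_eq hg hgf h]

/-- A generator other than `f` acts on `J` trivially or as a signed bump. -/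
theorem exists_stack_of_ne (D : ExcisionData X m E J f) {g g' : Homeo01} (hg : g ∈ X)
    (hgf : g ≠ f) (h : IsQuot g E g') (υ : Bool) :
    ∃ Φ, (Φ = 1 ∨ ∃ c σ, Stack (usedBumps X) m E J Φ c σ) ∧
      ∀ p ∈ J, signed g υ p = Φ p ∧ signed g' υ p = Φ p := by
  rw [D.quot_eq hg hgf h]
  simp only [and_self]
  by_cases hfix : ∀ p ∈ J, signed g υ p = p
  · exact ⟨1, Or.inl rfl, hfix⟩
  push Not at hfix
  obtain ⟨q, hqJ, hq⟩ := hfix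
  have hqg : q ∈ supt g := by
    cases υ
    · rw [← supt_inv]; exact hq
    · exact hq
  obtain ⟨c, hc, hqc⟩ := exists_usedIn (D.isOPH g hg) hqg
  have hcX : c ∈ usedBumps X := ⟨g, hg, hc⟩
  have hJ : J ⊆ supt c := hc.1.subset_supt_of_disjoint_feet (D.isMarking c hcX) D.ordConnected
    (D.disjoint g hg hgf c hc) hqJ hqc
  obtain ⟨σ, hσ⟩ := hc.exists_signed υ
  exact ⟨signed c σ, Or.inr ⟨c, σ, .single c σ hcX (D.notMem_of_usedIn hg hgf hc) hJ
    (D.disjoint g hg hgf c hc)⟩, fun p hp => hσ (hJ hp)⟩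

/-- A generator acts on the image of `J` under a stack by pushing, popping, or trivially. -/
theorem exists_stack_of_stack (D : ExcisionData X m E J f) {g g' : Homeo01} (hg : g ∈ X)
    (h : IsQuot g E g') (υ : Bool) {Φ b : Homeo01} {τ : Bool}
    (hΦ : Stack (usedBumps X) m E J Φ b τ) :
    ∃ Φ', (Φ' = 1 ∨ ∃ c σ, Stack (usedBumps X) m E J Φ' c σ) ∧
      ∀ p ∈ J, signed g υ (Φ p) = Φ' p ∧ signed g' υ (Φ p) = Φ' p := by
  have hfoot : ∀ p ∈ J, Φ p ∈ foot b (m b) τ := fun p hp =>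
    hΦ.apply_mem_foot isPosBump_of_mem_usedBumps D.feetDisjoint hp
  have hbU : ∀ t ∈ foot b (m b) τ, t ∉ unionSupt E := fun t ht =>
    D.notMem_unionSupt_of_mem_foot hΦ.mem hΦ.notMem ht
  suffices ∃ Φ', (Φ' = 1 ∨ ∃ c σ, Stack (usedBumps X) m E J Φ' c σ) ∧
      ∀ p ∈ J, signed g υ (Φ p) = Φ' p by
    obtain ⟨Φ', h1, h2⟩ := this
    exact ⟨Φ', h1, fun p hp => ⟨h2 p hp, by
      rw [D.signed_quot_apply_of_notMem hg h (hbU _ (hfoot p hp)), h2 p hp]⟩⟩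
  by_cases hfix : ∀ t ∈ foot b (m b) τ, signed g υ t = t
  · exact ⟨Φ, Or.inr ⟨b, τ, hΦ⟩, fun p hp => hfix _ (hfoot p hp)⟩
  push Not at hfix
  obtain ⟨q, hqb, hq⟩ := hfix
  have hqg : q ∈ supt g := by
    cases υ
    · rw [← supt_inv]; exact hq
    · exact hq
  obtain ⟨c, hc, hqc⟩ := exists_usedIn (D.isOPH g hg) hqg
  have hcX : c ∈ usedBumps X := ⟨g, hg, hc⟩
  have hcE : c ∉ E := fun hcE => hbU q hqb ⟨c, hcE, hqc⟩
  have hsub : foot b (m b) τ ⊆ supt c := by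
    by_cases hbc : b = c
    · subst hbc
      exact foot_subset_supt _ _ _
    · exact hc.1.subset_supt_of_disjoint_feet (D.isMarking c hcX)
        ((isPosBump_of_mem_usedBumps b hΦ.mem).foot_ordConnected τ)
        (fun σ => D.feetDisjoint c hcX b hΦ.mem σ τ fun h => hbc (congrArg Prod.fst h).symm)
        hqb hqc
  obtain ⟨σ, hσ⟩ := hc.exists_signed υ
  refine ⟨signed c σ * Φ, ?_, fun p hp => hσ (hsub (hfoot p hp))⟩
  by_cases hne : (b, τ) = (c, !σ)
  · obtain ⟨rfl, rfl⟩ := Prod.mk.inj hne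
    simpa using hΦ.pop
  · exact Or.inr ⟨c, σ, .cons Φ b c τ σ hΦ hcX hcE hne hsub⟩

theorem signed_zpow_apply (f : Homeo01) (υ : Bool) (k : ℤ) (p : UI) :
    signed f υ ((f ^ k) p) = (f ^ (k + cond υ 1 (-1))) p := by
  cases υ
  · simp [signed, add_comm k, zpow_add]
  · simp [signed, add_comm k, zpow_add]

/-- The trajectories of a word from the excised supports, before and after excision, and from
points staying in `J` under small powers of `f`, follow the same stack of signed bumps. -/
theorem exists_stack (D : ExcisionData X m E J f) {q : X → Homeo01}
    (hq : ∀ x : X, IsQuot x E (q x)) (L : List (X × Bool)) :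
    ∃ (k : ℤ) (Φ : Homeo01), |k| ≤ L.length ∧
      (Φ = 1 ∨ ∃ c σ, Stack (usedBumps X) m E J Φ c σ) ∧
      (∀ p ∈ unionSupt E, evalWord Subtype.val L p = Φ ((f ^ k) p)) ∧
      (∀ p ∈ unionSupt E, evalWord q L p = Φ p) ∧
      ∀ p, (∀ j : ℤ, |j| ≤ L.length → (f ^ j) p ∈ J \ unionSupt E) →
        evalWord q L p = Φ ((f ^ k) p) := by
  induction L with
  | nil => exact ⟨0, 1, by simp, Or.inl rfl, by simp [evalWord], by simp [evalWord],
      by simp [evalWord]⟩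
  | cons x L ih =>
    obtain ⟨k, Φ, hk, hΦ, h1, h2, h3⟩ := ih
    have hlen : ((x :: L).length : ℤ) = L.length + 1 := by simp
    simp only [evalWord_cons, hlen]
    by_cases hfree : Φ = 1 ∧ (x.1 : Homeo01) = f
    · obtain ⟨rfl, hxf⟩ := hfree
      refine ⟨k + cond x.2 1 (-1), 1, ?_, Or.inl rfl, fun p hp => ?_, fun p hp => ?_,
        fun p hp => ?_⟩
      · refine (abs_add_le _ _).trans (add_le_add hk ?_)
        cases x.2 <;> simp
      · rw [h1 p hp, hxf]
        exact signed_zpow_apply f _ k p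
      · rw [h2 p hp]
        exact D.signed_quot_apply_of_mem (hxf ▸ hq x.1) hp _
      · rw [h3 p fun j hj => hp j (hj.trans (by simp))]
        refine (D.signed_quot_apply_of_notMem x.1.2 (hq x.1) (hp k (hk.trans (by simp))).2
          x.2).trans ?_
        rw [hxf]
        exact signed_zpow_apply f _ k p
    · obtain ⟨Φ', hΦ', hstep⟩ : ∃ Φ',
          (Φ' = 1 ∨ ∃ c σ, Stack (usedBumps X) m E J Φ' c σ) ∧
          ∀ p ∈ J, signed x.1 x.2 (Φ p) = Φ' p ∧ signed (q x.1) x.2 (Φ p) = Φ' p := by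
        rcases hΦ with rfl | ⟨c, σ, hΦ⟩
        · exact D.exists_stack_of_ne x.1.2 (fun h => hfree ⟨rfl, h⟩) (hq x.1) x.2
        · exact D.exists_stack_of_stack x.1.2 (hq x.1) x.2 hΦ
      refine ⟨k, Φ', hk.trans (by simp), hΦ', fun p hp => ?_, fun p hp => ?_, fun p hp => ?_⟩
      · rw [h1 p hp]
        exact (hstep _ (D.unionSupt_subset (D.zpow_apply_mem_unionSupt hp k))).1
      · rw [h2 p hp]
        exact (hstep _ (D.unionSupt_subset hp)).2
      · rw [h3 p fun j hj => hp j (hj.trans (by simp))]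
        exact (hstep _ (hp k (hk.trans (by simp))).1).2

/-- If the foot of a bump used in `f` and outside `E` lies in `J`, then there are points of `J`
moved by `f` whose small powers stay in `J` and off the excised supports. -/
theorem exists_zpow_mem (D : ExcisionData X m E J f) {a : Homeo01} (ha : UsedIn f a)
    (haE : a ∉ E) {τ : Bool} (hJ : foot a (m a) τ ⊆ J) (n : ℕ) :
    ∃ p, (∀ j : ℤ, |j| ≤ n → (f ^ j) p ∈ J \ unionSupt E) ∧
      ∀ k : ℤ, (f ^ k) p = p → k = 0 := by
  have haX : a ∈ usedBumps X := ⟨f, D.mem, ha⟩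
  have hma := D.isMarking a haX
  obtain ⟨ε, hε, hpow⟩ := ha.exists_zpow
  have hmono := ha.1.strictMono_zpow hma
  have hshift : ∀ N i : ℤ, (a ^ i) ((a ^ N) (m a)) = (a ^ (i + N)) (m a) := fun N i => by
    rw [zpow_add, Equiv.Perm.mul_apply]
  obtain ⟨N, hN⟩ : ∃ N : ℤ, ∀ i : ℤ, |i| ≤ n → (a ^ (i + N)) (m a) ∈ foot a (m a) τ := by
    cases τ
    · refine ⟨-n - 1, fun i hi => ⟨zpow_apply_mem_supt hma _, ?_⟩⟩
      have : i + (-n - 1) < 0 := by linarith [le_abs_self i]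
      simpa using hmono this
    · refine ⟨n + 1, fun i hi => ⟨zpow_apply_mem_supt hma _, ?_⟩⟩
      have : 1 ≤ i + (n + 1) := by linarith [neg_abs_le i]
      simpa using hmono.monotone this
  have hp : (a ^ N) (m a) ∈ supt a := zpow_apply_mem_supt hma N
  refine ⟨(a ^ N) (m a), fun j hj => ?_, fun k hk => ?_⟩
  · rw [hpow _ hp, hshift]
    have hmem := hN (ε * j) (by rcases hε with rfl | rfl <;> simpa using hj)
    exact ⟨hJ hmem, D.notMem_unionSupt_of_mem_foot haX haE hmem⟩
  · rw [hpow _ hp, hshift] at hk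
    have := hmono.injective hk
    rcases hε with rfl | rfl <;> linarith

/-- A homomorphism acts trivially at `ρ u p` exactly when a conjugate acts trivially at `p`. -/
theorem apply_eq_iff_conj {G : Type*} [Group G] (ρ : G →* Homeo01) (g u : G) (p : UI) :
    ρ g (ρ u p) = ρ u p ↔ ρ (u⁻¹ * g * u) p = p := by
  simp only [map_mul, map_inv, Equiv.Perm.mul_apply]
  rw [Equiv.Perm.inv_eq_iff_eq]

theorem lift_mk_eq {X : Set Homeo01} (F : X → Homeo01) (L : List (X × Bool)) :
    FreeGroup.lift F (FreeGroup.mk L) = evalWord F L := FreeGroup.lift_mk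

/-- Excision does not change the relations between the generators. -/
theorem lift_eq_one_iff (D : ExcisionData X m E J f) {q : X → Homeo01}
    (hq : ∀ x : X, IsQuot x E (q x)) {a : Homeo01} (ha : UsedIn f a) (haE : a ∉ E) {τ : Bool}
    (hJ : foot a (m a) τ ⊆ J) (w : FreeGroup X) :
    FreeGroup.lift Subtype.val w = 1 ↔ FreeGroup.lift q w = 1 := by
  have hnotMem : ∀ {Φ c : Homeo01} {σ : Bool}, Stack (usedBumps X) m E J Φ c σ → ∀ p ∈ J,
      Φ p ∉ unionSupt E := fun hΦ p hp =>
    D.notMem_unionSupt_of_mem_foot hΦ.mem hΦ.notMem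
      (hΦ.apply_mem_foot isPosBump_of_mem_usedBumps D.feetDisjoint hp)
  constructor
  · intro hw
    ext1 t
    by_cases ht : ∃ u : FreeGroup X, ∃ p ∈ unionSupt E, FreeGroup.lift q u p = t
    · obtain ⟨u, p, hp, rfl⟩ := ht
      rw [Equiv.Perm.one_apply, apply_eq_iff_conj]
      have hv : FreeGroup.lift Subtype.val (u⁻¹ * w * u) = 1 := by simp [hw]
      obtain ⟨L, hL⟩ := Quot.exists_rep (u⁻¹ * w * u)
      change FreeGroup.mk L = _ at hL
      rw [← hL, lift_mk_eq] at hv ⊢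
      obtain ⟨k, Φ, -, hΦ, h1, h2, -⟩ := D.exists_stack hq L
      rcases hΦ with rfl | ⟨c, σ, hΦ⟩
      · exact h2 p hp
      · have h3 := h1 p hp
        rw [hv] at h3
        exact absurd (h3 ▸ hp) (hnotMem hΦ _
          (D.unionSupt_subset (D.zpow_apply_mem_unionSupt hp k)))
    · have key : ∀ L : List (X × Bool), evalWord Subtype.val L t = evalWord q L t := by
        intro L
        induction L with
        | nil => rfl
        | cons x L ih =>
          rw [evalWord_cons, evalWord_cons, ih, D.signed_quot_apply_of_notMem x.1.2 (hq x.1)]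
          intro h
          refine ht ⟨(FreeGroup.mk L)⁻¹, _, h, ?_⟩
          rw [map_inv, lift_mk_eq]
          simp
      obtain ⟨L, rfl⟩ := Quot.exists_rep w
      exact (key L).symm.trans (DFunLike.congr_fun hw t)
  · intro hw
    ext1 t
    by_cases ht : ∃ u : FreeGroup X, ∃ p ∈ unionSupt E, FreeGroup.lift Subtype.val u p = t
    · obtain ⟨u, p, hp, rfl⟩ := ht
      rw [Equiv.Perm.one_apply, apply_eq_iff_conj]
      have hv : FreeGroup.lift q (u⁻¹ * w * u) = 1 := by simp [hw]
      obtain ⟨L, hL⟩ := Quot.exists_rep (u⁻¹ * w * u)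
      change FreeGroup.mk L = _ at hL
      rw [← hL, lift_mk_eq] at hv ⊢
      obtain ⟨k, Φ, -, hΦ, h1, h2, h3⟩ := D.exists_stack hq L
      rcases hΦ with rfl | ⟨c, σ, hΦ⟩
      · obtain ⟨s, hs, hfree⟩ := D.exists_zpow_mem ha haE hJ L.length
        have h4 := h3 s hs
        rw [hv] at h4
        rw [h1 p hp, hfree k h4.symm]
        simp
      · have h4 := h2 p hp
        rw [hv] at h4
        exact absurd (h4 ▸ hp) (hnotMem hΦ _ (D.unionSupt_subset hp))
    · have key : ∀ L : List (X × Bool), evalWord q L t = evalWord Subtype.val L t := by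
        intro L
        induction L with
        | nil => rfl
        | cons x L ih =>
          rw [evalWord_cons, evalWord_cons, ih, D.signed_quot_apply_of_notMem x.1.2 (hq x.1)]
          intro h
          refine ht ⟨(FreeGroup.mk L)⁻¹, _, h, ?_⟩
          rw [map_inv, lift_mk_eq]
          simp
      obtain ⟨L, rfl⟩ := Quot.exists_rep w
      exact (key L).symm.trans (DFunLike.congr_fun hw t)

end ExcisionData

/-- Homomorphisms with the same kernel have isomorphic ranges. -/
theorem exists_mulEquiv_of_ker_eq {F G : Type*} [Group F] [Group G] {ρ ρ' : F →* G}
    (h : ρ.ker = ρ'.ker) {H H' : Subgroup G} (hH : ρ.range = H) (hH' : ρ'.range = H') :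
    ∃ φ : H ≃* H', ∀ (w : F) (hw : ρ w ∈ H), (φ ⟨ρ w, hw⟩ : G) = ρ' w := by
  subst hH hH'
  refine ⟨(QuotientGroup.quotientKerEquivRange ρ).symm.trans
    ((QuotientGroup.quotientMulEquivOfEq h).trans (QuotientGroup.quotientKerEquivRange ρ')),
    fun w hw => ?_⟩
  have : (QuotientGroup.quotientKerEquivRange ρ).symm ⟨ρ w, hw⟩ = (w : F ⧸ ρ.ker) := by
    rw [MulEquiv.symm_apply_eq]
    rfl
  simp only [MulEquiv.trans_apply, this]
  rfl

/-- **Theorem (Excision).** Let `X ⊆ Homeo₊(I)` be a (possibly infinite)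
geometrically fast set with a fixed marking of its used bumps, and let `E` be an
extraneous set of bumps in `X`. Then `g ↦ g/E` extends to an isomorphism from
`⟨X⟩` onto `⟨X/E⟩`. -/
theorem excision (X : Set Homeo01) (m : Homeo01 → UI)
    (hX : ∀ f ∈ X, IsOPH f) (hprop : GeomProper X)
    (hm : IsMarking (usedBumps X) m) (hfd : FeetDisjoint (usedBumps X) m)
    (E : Set Homeo01) (hE : ∀ e ∈ E, IsPosBump e)
    (hext : Extraneous X m E)
    (XE : Set Homeo01) (hXE : XE = {g : Homeo01 | ∃ f ∈ X, IsQuot f E g}) :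
    ∃ φ : Subgroup.closure X ≃* Subgroup.closure XE,
      ∀ (f : Homeo01) (hfX : f ∈ X), ∀ g : Homeo01, IsQuot f E g →
        (↑(φ ⟨f, Subgroup.subset_closure hfX⟩) : Homeo01) = g := by
  obtain ⟨J, hJ, f, hf, hEf, ⟨a, ha, haE, haJ⟩, hd⟩ := hext
  have D : ExcisionData X m E J f :=
    { isOPH := hX
      isMarking := hm
      feetDisjoint := hfd
      ordConnected := hJ
      mem := hf
      usedIn := fun e he => (hEf e he).1
      isolatedIn := fun e he => (hEf e he).2.1
      supt_subset := fun e he => (hEf e he).2.2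
      disjoint := fun g hg hgf b hb σ => by
        cases σ
        exacts [(hd g hg hgf b hb).1, (hd g hg hgf b hb).2] }
  obtain ⟨τ, hτ⟩ : ∃ τ, foot a (m a) τ ⊆ J := by
    rcases haJ with h | h
    exacts [⟨false, h⟩, ⟨true, h⟩]
  choose q hq using fun x : X => D.exists_isQuot x.2
  have huniq : ∀ {g g₁ g₂ : Homeo01}, IsQuot g E g₁ → IsQuot g E g₂ → g₁ = g₂ := by
    intro g g₁ g₂ h₁ h₂
    ext1 t
    by_cases ht : t ∈ quotSupp g E
    · rw [h₁.1 t ht, h₂.1 t ht]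
    · rw [h₁.2 t ht, h₂.2 t ht]
  have hrange : Set.range q = XE := by
    subst hXE
    ext g
    constructor
    · rintro ⟨x, rfl⟩
      exact ⟨x, x.2, hq x⟩
    · rintro ⟨x, hx, hg⟩
      exact ⟨⟨x, hx⟩, huniq (hq ⟨x, hx⟩) hg⟩
  obtain ⟨φ, hφ⟩ := exists_mulEquiv_of_ker_eq
    (ρ := FreeGroup.lift (Subtype.val : X → Homeo01)) (ρ' := FreeGroup.lift q)
    (Subgroup.ext fun w => D.lift_eq_one_iff hq ha haE hτ w)
    (FreeGroup.closure_eq_range X).symm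
    (by rw [FreeGroup.range_lift_eq_closure, hrange])
  refine ⟨φ, fun x hx g hg => ?_⟩
  have key := hφ (FreeGroup.of ⟨x, hx⟩)
  simp only [FreeGroup.lift_apply_of] at key
  exact (key (Subgroup.subset_closure hx)).trans (huniq (hq ⟨x, hx⟩) hg)

end PingPong
end
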